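/- Let V ≥ 0 with e^{2V} − 1 ≤ 1/2 and μ > 0. Let m : ℝ³ → ℝ³ be a Lebesgue measure-preserving bijection satisfying, for all y ≠ 0: (i) e^{-V}|y| ≤ |m(±y)| ≤ e^{V}|y| and e^{-V}|y|_{1/F} ≤ |m(±y)|_{1/F} ≤ e^{V}|y|_{1/F}; (ii) |m(−y) − y| ≤ e^{2V}(e^{2V} − 1)|y| and |m(y) + y| ≤ e^{2V}(e^{2V} − 1)|y|; (iii) |m(−y) + m(y)| ≤ e^{2V}(e^{2V} − 1) min(1, μ|y|)|y|; (iv) | |m(−y)| − |m(y)| | ≤ e^{2V}(e^{2V} − 1) min(1, μ|y|)|y| and the analogous bound for |·|_{1/F}. Let h : ℝ³ → ℝ be a bounded C² function with bounded first and second derivatives and h(0) = 0. Then the limit L = lim_{ε→0⁺} [ ∫_{{|y| ≥ ε}} K₀(y) h(y) dy − ∫_{{|m(−y)| ≥ ε}} K₀(m(−y)) h(y) dy ] exists, the two integrals 𝔸 = ∫_{ℝ³} (K₀(y) − K₀(m(−y)))(h(y) + h(−y)) dy and 𝔹 = ∫_{ℝ³} (K₀(m(−y)) − K₀(m(y)))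 h(−y) dy converge absolutely, and L = (1/2)(𝔸 + 𝔹). -/

import Mathlib

open MeasureTheory Filter
open scoped Real Topology

noncomputable section

/-- `|x|_{1/F}² = x₁² + x₂² + x₃²/F²`. -/
def normInvFsq (F : ℝ) (x : EuclideanSpace ℝ (Fin 3)) : ℝ :=
  x 0 ^ 2 + x 1 ^ 2 + x 2 ^ 2 / F ^ 2

/-- `|x|_{1/F} = √(x₁² + x₂² + x₃²/F²)`. -/
def normInvF (F : ℝ) (x : EuclideanSpace ℝ (Fin 3)) : ℝ :=
  Real.sqrt (normInvFsq F x)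

/-- The kernel `K₀(y) = −(2/F²)(y₁² + y₂² − 3y₃²/F²)/|y|_{1/F}⁶`. -/
def K₀ (F : ℝ) (y : EuclideanSpace ℝ (Fin 3)) : ℝ :=
  -(2 / F ^ 2) * (y 0 ^ 2 + y 1 ^ 2 - 3 * y 2 ^ 2 / F ^ 2) / (normInvFsq F y) ^ 3

section SingularIntegral

variable {E : Type*} [NormedAddCommGroup E] {K h : E → ℝ} {p q : E → E} {a A B C D c ε : ℝ}

/-- A function on `E` with bounded second derivative that vanishes at the origin has symmetric
second difference of quadratic size. -/
lemma abs_add_comp_neg_le [NormedSpace ℝ E] (hh : ContDiff ℝ 2 h) (hh0 : h 0 = 0)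
    (hB : ∀ x, ‖iteratedFDeriv ℝ 2 h x‖ ≤ B) (y : E) :
    |h y + h (-y)| ≤ 2 * B * ‖y‖ ^ 2 := by
  have hd : Differentiable ℝ h := hh.differentiable (by norm_num)
  have hd' : Differentiable ℝ (fderiv ℝ h) :=
    (hh.fderiv_right (m := 1) (by norm_num)).differentiable (by norm_num)
  have hlip (x z : E) : ‖fderiv ℝ h x - fderiv ℝ h z‖ ≤ B * ‖x - z‖ := by
    refine convex_univ.norm_image_sub_le_of_norm_fderiv_le (𝕜 := ℝ) (fun w _ => hd' w)
      (fun w _ => ?_) (Set.mem_univ _) (Set.mem_univ _)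
    rw [← norm_iteratedFDeriv_one, norm_iteratedFDeriv_fderiv]
    exact hB w
  have hB0 : 0 ≤ B := (norm_nonneg _).trans (hB 0)
  have hderiv (x : E) :
      HasFDerivAt (fun x => h x + h (-x)) (fderiv ℝ h x - fderiv ℝ h (-x)) x := by
    have h₁ := (hd (-x)).hasFDerivAt.comp x (hasFDerivAt_id x).neg
    refine ((hd x).hasFDerivAt.add h₁).congr_fderiv ?_
    ext v
    simp [sub_eq_add_neg]
  have key := (convex_closedBall (0 : E) ‖y‖).norm_image_sub_le_of_norm_hasFDerivWithin_le
    (f := fun x => h x + h (-x)) (C := 2 * B * ‖y‖) (x := 0) (y := y)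
    (fun x _ => (hderiv x).hasFDerivWithinAt) (fun x hx => ?_) (by simp) (by simp)
  · simpa [hh0, pow_two, mul_assoc] using key
  · refine (hlip x (-x)).trans ?_
    have hx' : ‖x‖ ≤ ‖y‖ := by simpa using hx
    have : ‖x - -x‖ ≤ 2 * ‖y‖ := by
      rw [sub_neg_eq_add]
      linarith [norm_add_le x x]
    nlinarith

/-- The kernel `K` cut off inside the ball of radius `ε`. -/
def truncatedKernel (K : E → ℝ) (ε : ℝ) (z : E) : ℝ :=
  {z : E | ε ≤ ‖z‖}.indicator K z

lemma truncatedKernel_neg (hK : ∀ z, K (-z) = K z) (ε : ℝ) (z : E) :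
    truncatedKernel K ε (-z) = truncatedKernel K ε z := by
  simp [truncatedKernel, Set.indicator_apply, hK]

lemma abs_truncatedKernel_le (K : E → ℝ) (ε : ℝ) (z : E) : |truncatedKernel K ε z| ≤ |K z| := by
  simpa [truncatedKernel] using norm_indicator_le_norm_self K z

lemma tendsto_truncatedKernel (K : E → ℝ) {z : E} (hz : z ≠ 0) :
    Tendsto (fun ε => truncatedKernel K ε z) (𝓝[>] 0) (𝓝 (K z)) := by
  refine tendsto_const_nhds.congr' ?_
  filter_upwards [Ioo_mem_nhdsGT (norm_pos_iff.2 hz)] with ε hε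
  exact (Set.indicator_of_mem (show z ∈ {z : E | ε ≤ ‖z‖} from hε.2.le) K).symm

lemma abs_comp_le (ha : 0 < a) (hKb : ∀ z, |K z| ≤ C / ‖z‖ ^ 4)
    (hql : ∀ y, a * ‖y‖ ≤ ‖q y‖) (hqu : ∀ y, ‖q y‖ ≤ A * ‖y‖) (hC : 0 ≤ C) (y : E) :
    |K (q y)| ≤ C / a ^ 4 / ‖y‖ ^ 4 := by
  rcases eq_or_ne y 0 with rfl | hy
  · have hq0 : q 0 = 0 := norm_le_zero_iff.1 (by simpa using hqu 0)
    simpa [hq0] using hKb 0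
  · have hy := norm_pos_iff.2 hy
    refine (hKb _).trans ?_
    rw [div_div, ← mul_pow]
    have := hql y
    gcongr

/-- Replacing the cutoff `ε ≤ ‖p (-y)‖` by the cutoff `ε ≤ ‖p y‖` changes the integrand only on the
preimages of a spherical shell of thickness `O(ε²)`. -/
lemma abs_truncatedKernel_sub_mul_le
    (hKb : ∀ z, |K z| ≤ C / ‖z‖ ^ 4) (hC : 0 ≤ C) (ha : 0 < a) (hA : 0 < A) (hc : 0 ≤ c)
    (hpl : ∀ y, a * ‖y‖ ≤ ‖p y‖) (hpu : ∀ y, ‖p y‖ ≤ A * ‖y‖)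
    (hp2 : ∀ y, |‖p y‖ - ‖p (-y)‖| ≤ c * ‖y‖ ^ 2)
    (hhb : ∀ y, |h y| ≤ B * ‖y‖) (hB : 0 ≤ B) (hε : 0 < ε) (y : E) :
    |({y : E | ε ≤ ‖p y‖}.indicator (fun y => K (p (-y))) y - truncatedKernel K ε (p (-y))) *
        h (-y)| ≤
      C / a ^ 4 * B * (A / ε) ^ 3 *
        ((p ⁻¹' {z : E | ε ≤ ‖z‖ ∧ ‖z‖ ≤ ε + c / a ^ 2 * ε ^ 2}).indicator 1 y +
        ((fun y => p (-y)) ⁻¹' {z : E | ε ≤ ‖z‖ ∧ ‖z‖ ≤ ε + c / a ^ 2 * ε ^ 2}).indicator 1 y) := by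
  have hpl' (y : E) : a * ‖y‖ ≤ ‖p (-y)‖ := by simpa using hpl (-y)
  have hpu' (y : E) : ‖p (-y)‖ ≤ A * ‖y‖ := by simpa using hpu (-y)
  have hprod (hy : ε ≤ A * ‖y‖) : |K (p (-y)) * h (-y)| ≤ C / a ^ 4 * B * (A / ε) ^ 3 := by
    have hy0 : 0 < ‖y‖ := by
      by_contra! h0
      nlinarith
    have h1 : ‖y‖⁻¹ ≤ A / ε := by
      rw [inv_le_iff_one_le_mul₀ hy0, div_mul_eq_mul_div, le_div_iff₀ hε, one_mul]
      exact hy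
    calc |K (p (-y)) * h (-y)| ≤ C / a ^ 4 / ‖y‖ ^ 4 * (B * ‖y‖) := by
          rw [abs_mul]
          gcongr
          · exact abs_comp_le (q := fun y => p (-y)) ha hKb hpl' hpu' hC y
          · simpa using hhb (-y)
      _ = C / a ^ 4 * B * ‖y‖⁻¹ ^ 3 := by field_simp
      _ ≤ _ := by gcongr
  have hM : 0 ≤ C / a ^ 4 * B * (A / ε) ^ 3 := by positivity
  have hshell {s t : ℝ} (hs : a * ‖y‖ ≤ s) (hsε : s < ε) (hst : |s - t| ≤ c * ‖y‖ ^ 2) :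
      t ≤ ε + c / a ^ 2 * ε ^ 2 := by
    have h1 : c * ‖y‖ ^ 2 ≤ c / a ^ 2 * ε ^ 2 := by
      have : (a * ‖y‖) ^ 2 ≤ ε ^ 2 := by
        have := hs.trans hsε.le
        gcongr
      rw [div_mul_eq_mul_div, le_div_iff₀ (by positivity)]
      nlinarith
    linarith [(abs_le.1 hst).1]
  have hnn (s : Set E) : (0 : ℝ) ≤ s.indicator 1 y := Set.indicator_nonneg (by simp) y
  set S := {z : E | ε ≤ ‖z‖ ∧ ‖z‖ ≤ ε + c / a ^ 2 * ε ^ 2}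
  have hrhs := mul_nonneg hM (add_nonneg (hnn (p ⁻¹' S)) (hnn ((fun y => p (-y)) ⁻¹' S)))
  by_cases h1 : ε ≤ ‖p y‖ <;> by_cases h2 : ε ≤ ‖p (-y)‖
  · simp only [truncatedKernel, Set.indicator_apply, Set.mem_ofPred_eq, h1, h2, if_true, sub_self,
      zero_mul, abs_zero]
    exact hrhs
  · have hmem : ‖p y‖ ≤ ε + c / a ^ 2 * ε ^ 2 :=
      hshell (hpl' y) (not_le.1 h2) (by rw [abs_sub_comm]; exact hp2 y)
    have := hprod (h1.trans (hpu y))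
    have hnn' := hnn ((fun y => p (-y)) ⁻¹' S)
    rw [Set.indicator_of_mem (show y ∈ p ⁻¹' S from ⟨h1, hmem⟩)]
    simp only [truncatedKernel, Set.indicator_apply, Set.mem_ofPred_eq, h1, h2, if_true, if_false,
      sub_zero, Pi.one_apply] at hnn' ⊢
    nlinarith
  · have hmem : ‖p (-y)‖ ≤ ε + c / a ^ 2 * ε ^ 2 := hshell (hpl y) (not_le.1 h1) (hp2 y)
    have := hprod (h2.trans (hpu' y))
    have hnn' := hnn (p ⁻¹' S)
    rw [Set.indicator_of_mem (show y ∈ (fun y => p (-y)) ⁻¹' S from ⟨h2, hmem⟩)]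
    simp only [truncatedKernel, Set.indicator_apply, Set.mem_ofPred_eq, h1, h2, if_true, if_false,
      zero_sub, Pi.one_apply, neg_mul, abs_neg] at hnn' ⊢
    nlinarith
  · simp only [truncatedKernel, Set.indicator_apply, Set.mem_ofPred_eq, h1, h2, if_false, sub_self,
      zero_mul, abs_zero]
    exact hrhs

variable [MeasurableSpace E]

lemma measurable_truncatedKernel [OpensMeasurableSpace E] (hK : Measurable K) (ε : ℝ) :
    Measurable (truncatedKernel K ε) :=
  hK.indicator (measurableSet_le measurable_const measurable_norm)

lemma setIntegral_eq_integral_truncatedKernel [OpensMeasurableSpace E] {ν : Measure E}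
    (hq : Measurable q) (ε : ℝ) :
    ∫ y in {y : E | ε ≤ ‖q y‖}, K (q y) * h y ∂ν = ∫ y, truncatedKernel K ε (q y) * h y ∂ν := by
  rw [← integral_indicator (measurableSet_le measurable_const hq.norm)]
  congr 1 with y
  simp [truncatedKernel, Set.indicator_apply]

variable [NormedSpace ℝ E] [FiniteDimensional ℝ E] [BorelSpace E]

lemma integrable_min_one_norm_sq_div_norm_pow_four (hE : Module.finrank ℝ E = 3)
    (ν : Measure E) [ν.IsAddHaarMeasure] :
    Integrable (fun y : E => min 1 (‖y‖ ^ 2) / ‖y‖ ^ 4) ν := by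
  have : Nontrivial E := Module.nontrivial_of_finrank_pos (R := ℝ) (by omega)
  rw [integrable_fun_norm_addHaar ν (f := fun t : ℝ => min 1 (t ^ 2) / t ^ 4), hE]
  refine ((integrable_inv_one_add_sq.const_mul 2).integrableOn).mono'
    (by fun_prop) ?_
  filter_upwards [ae_restrict_mem measurableSet_Ioi] with t ht
  have ht : 0 < t := ht
  have hpos : 0 < 1 + t ^ 2 := by positivity
  rw [Real.norm_of_nonneg (by positivity)]
  have : t ^ (3 - 1) • (min 1 (t ^ 2) / t ^ 4) = min 1 (t ^ 2) / t ^ 2 := by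
    simp only [smul_eq_mul]
    field_simp
  rw [this, ← div_eq_mul_inv, div_le_div_iff₀ (by positivity) hpos]
  rcases le_total 1 (t ^ 2) with h | h
  · rw [min_eq_left h]; linarith
  · rw [min_eq_right h]; nlinarith [sq_nonneg t]

variable (ν : Measure E) [ν.IsAddHaarMeasure]

lemma measureReal_norm_mem_Icc (hE : Module.finrank ℝ E = 3) {r s : ℝ} (hr : 0 ≤ r)
    (hrs : r ≤ s) :
    ν.real {z : E | r ≤ ‖z‖ ∧ ‖z‖ ≤ s} = (s ^ 3 - r ^ 3) * ν.real (Metric.ball 0 1) := by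
  have : Nontrivial E := Module.nontrivial_of_finrank_pos (R := ℝ) (by omega)
  have hset : {z : E | r ≤ ‖z‖ ∧ ‖z‖ ≤ s} = Metric.closedBall 0 s \ Metric.ball 0 r := by
    ext z
    simp [and_comm]
  rw [hset, measureReal_sdiff (Metric.ball_subset_closedBall.trans
      (Metric.closedBall_subset_closedBall hrs)) measurableSet_ball
      measure_closedBall_lt_top.ne,
    ← Measure.addHaar_real_closedBall_eq_addHaar_real_ball,
    Measure.addHaar_real_closedBall _ _ hr, Measure.addHaar_real_closedBall _ _ (hr.trans hrs), hE]
  ring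

variable {ν}

lemma integrable_truncatedKernel_comp_mul (hE : Module.finrank ℝ E = 3)
    (hK : Measurable K) (hKb : ∀ z, |K z| ≤ C / ‖z‖ ^ 4) (hC : 0 ≤ C)
    (hq : Measurable q) (ha : 0 < a) (hA : 0 < A)
    (hql : ∀ y, a * ‖y‖ ≤ ‖q y‖) (hqu : ∀ y, ‖q y‖ ≤ A * ‖y‖)
    (hh : Measurable h) (hhb : ∀ y, |h y| ≤ B) (hε : 0 < ε) :
    Integrable (fun y => truncatedKernel K ε (q y) * h y) ν := by
  have hB : 0 ≤ B := (abs_nonneg _).trans (hhb 0)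
  refine ((integrable_min_one_norm_sq_div_norm_pow_four hE ν).const_mul
    (C / a ^ 4 * B * (1 + (A / ε) ^ 2))).mono'
    (((measurable_truncatedKernel hK ε).comp hq).mul hh).aestronglyMeasurable
    (ae_of_all _ fun y => ?_)
  by_cases hy : ε ≤ ‖q y‖
  · have h1 : ε / A ≤ ‖y‖ := by
      rw [div_le_iff₀' hA]
      exact hy.trans (hqu y)
    have hy0 : 0 < ‖y‖ := (by positivity : 0 < ε / A).trans_le h1
    have h2 : 1 ≤ (1 + (A / ε) ^ 2) * min 1 (‖y‖ ^ 2) := by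
      rcases le_total 1 (‖y‖ ^ 2) with h | h
      · rw [min_eq_left h]; nlinarith [sq_nonneg (A / ε)]
      · rw [min_eq_right h]
        have : A / ε * (ε / A) = 1 := by field_simp
        have h3 : 1 ≤ A / ε * ‖y‖ := by
          rw [← this]; gcongr
        nlinarith [sq_nonneg ‖y‖]
    calc ‖truncatedKernel K ε (q y) * h y‖
        = |truncatedKernel K ε (q y)| * |h y| := by simp
      _ ≤ (C / a ^ 4 / ‖y‖ ^ 4) * B := by
          gcongr
          · exact (abs_truncatedKernel_le K ε _).trans (abs_comp_le ha hKb hql hqu hC y)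
          · exact hhb y
      _ ≤ (C / a ^ 4 / ‖y‖ ^ 4) * B * ((1 + (A / ε) ^ 2) * min 1 (‖y‖ ^ 2)) :=
          le_mul_of_one_le_right (by positivity) h2
      _ = _ := by ring
  · have : truncatedKernel K ε (q y) = 0 := Set.indicator_of_notMem (s := {z : E | ε ≤ ‖z‖}) hy K
    rw [this, zero_mul, norm_zero]
    positivity

lemma tendsto_integral_truncatedKernel_sub_mul (hE : Module.finrank ℝ E = 3)
    (hKb : ∀ z, |K z| ≤ C / ‖z‖ ^ 4) (hC : 0 ≤ C)
    (hp : MeasurePreserving p ν ν) (ha : 0 < a) (hA : 0 < A) (hc : 0 ≤ c)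
    (hpl : ∀ y, a * ‖y‖ ≤ ‖p y‖) (hpu : ∀ y, ‖p y‖ ≤ A * ‖y‖)
    (hp2 : ∀ y, |‖p y‖ - ‖p (-y)‖| ≤ c * ‖y‖ ^ 2)
    (hhb : ∀ y, |h y| ≤ B * ‖y‖) (hB : 0 ≤ B) :
    Tendsto (fun ε => ∫ y, ({y : E | ε ≤ ‖p y‖}.indicator (fun y => K (p (-y))) y -
      truncatedKernel K ε (p (-y))) * h (-y) ∂ν) (𝓝[>] 0) (𝓝 0) := by
  set v := ν.real (Metric.ball (0 : E) 1)
  set k := c / a ^ 2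
  have hk : 0 ≤ k := by positivity
  have hlim : Tendsto (fun ε : ℝ => C / a ^ 4 * B * A ^ 3 *
      (2 * v * (ε * (3 * k + 3 * k ^ 2 * ε + k ^ 3 * ε ^ 2)))) (𝓝[>] 0) (𝓝 0) := by
    have : Continuous (fun ε : ℝ => C / a ^ 4 * B * A ^ 3 *
      (2 * v * (ε * (3 * k + 3 * k ^ 2 * ε + k ^ 3 * ε ^ 2)))) := by fun_prop
    simpa using (this.tendsto 0).mono_left nhdsWithin_le_nhds
  refine squeeze_zero_norm' ?_ hlim
  filter_upwards [self_mem_nhdsWithin] with ε (hε : 0 < ε)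
  have hkε : 0 ≤ k * ε ^ 2 := by positivity
  set S := {z : E | ε ≤ ‖z‖ ∧ ‖z‖ ≤ ε + k * ε ^ 2}
  have hS : MeasurableSet S :=
    (measurableSet_le measurable_const measurable_norm).inter
      (measurableSet_le measurable_norm measurable_const)
  have hSv : ν.real S = ((ε + k * ε ^ 2) ^ 3 - ε ^ 3) * v :=
    measureReal_norm_mem_Icc ν hE hε.le (by linarith)
  have hSfin : ν S ≠ ⊤ := ((measure_mono (fun z hz => by simpa using hz.2)).trans_lt
    (measure_closedBall_lt_top (x := (0 : E)) (r := ε + k * ε ^ 2))).ne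
  have hshell {q : E → E} (hq : MeasurePreserving q ν ν) :
      Integrable ((q ⁻¹' S).indicator (1 : E → ℝ)) ν ∧
        ∫ y, (q ⁻¹' S).indicator (1 : E → ℝ) y ∂ν = ν.real S := by
    have hm := hq.measurable hS
    refine ⟨(integrable_indicator_iff hm).2 (integrableOn_const ?_), ?_⟩
    · rwa [hq.measure_preimage hS.nullMeasurableSet]
    · rw [integral_indicator_one hm, hq.measureReal_preimage hS.nullMeasurableSet]
  have h1 := hshell hp
  have h2 := hshell (hp.comp (Measure.measurePreserving_neg ν))
  refine (norm_integral_le_of_norm_le ((h1.1.add h2.1).const_mul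
    (C / a ^ 4 * B * (A / ε) ^ 3)) (ae_of_all _ fun y =>
      abs_truncatedKernel_sub_mul_le hKb hC ha hA hc hpl hpu hp2 hhb hB hε y)).trans_eq ?_
  rw [integral_const_mul]
  simp only [Pi.add_apply]
  rw [integral_add h1.1 h2.1, h1.2, h2.2, hSv]
  field_simp
  ring

theorem tendsto_truncated_commutator (hE : Module.finrank ℝ E = 3)
    (hK : Measurable K) (hKe : ∀ z, K (-z) = K z) (hKb : ∀ z, |K z| ≤ C / ‖z‖ ^ 4) (hC : 0 ≤ C)
    (hp : MeasurePreserving p ν ν) (ha : 0 < a) (hA : 0 < A) (hc : 0 ≤ c)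
    (hpl : ∀ y, a * ‖y‖ ≤ ‖p y‖) (hpu : ∀ y, ‖p y‖ ≤ A * ‖y‖)
    (hp2 : ∀ y, |‖p y‖ - ‖p (-y)‖| ≤ c * ‖y‖ ^ 2) (hD : 0 ≤ D)
    (hKd : ∀ y, |K (p y) - K (p (-y))| ≤ D * min 1 ‖y‖ / ‖y‖ ^ 4)
    (hh : Measurable h) (hhb : ∀ y, |h y| ≤ B * min 1 ‖y‖) (hB : 0 ≤ B)
    (hhs : ∀ y, |h y + h (-y)| ≤ B * min 1 (‖y‖ ^ 2)) :
    Integrable (fun y => (K y - K (p y)) * (h y + h (-y))) ν ∧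
    Integrable (fun y => (K (p y) - K (p (-y))) * h (-y)) ν ∧
    Tendsto (fun ε : ℝ => (∫ y in {y : E | ε ≤ ‖y‖}, K y * h y ∂ν) -
        ∫ y in {y : E | ε ≤ ‖p y‖}, K (p y) * h y ∂ν) (𝓝[>] 0)
      (𝓝 ((1 / 2) * ((∫ y, (K y - K (p y)) * (h y + h (-y)) ∂ν) +
          ∫ y, (K (p y) - K (p (-y))) * h (-y) ∂ν))) := by
  have hpm := hp.measurable
  have hpm' : Measurable (fun y => p (-y)) := hpm.comp measurable_neg
  have hhm' : Measurable (fun y => h (-y)) := hh.comp measurable_neg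
  have hnt : Nontrivial E := Module.nontrivial_of_finrank_pos (R := ℝ) (by omega)
  have hne : ∀ᵐ y ∂ν, y ≠ 0 := by simp [ae_iff]
  have hp0 {y : E} (hy : y ≠ 0) : p y ≠ 0 := by
    have := hpl y
    have hy := norm_pos_iff.2 hy
    exact norm_pos_iff.1 ((by positivity : 0 < a * ‖y‖).trans_le this)
  have hG := integrable_min_one_norm_sq_div_norm_pow_four hE ν
  have hboundA {s t : ℝ} (y : E) (hs : |s| ≤ |K y|) (ht : |t| ≤ |K (p y)|) :
      ‖(s - t) * (h y + h (-y))‖ ≤ (C + C / a ^ 4) * B * (min 1 (‖y‖ ^ 2) / ‖y‖ ^ 4) := by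
    have h1 : |s - t| ≤ (C + C / a ^ 4) / ‖y‖ ^ 4 := by
      rw [add_div]
      linarith [abs_sub s t, hKb y, abs_comp_le ha hKb hpl hpu hC y]
    calc ‖(s - t) * (h y + h (-y))‖ = |s - t| * |h y + h (-y)| := by simp
      _ ≤ ((C + C / a ^ 4) / ‖y‖ ^ 4) * (B * min 1 (‖y‖ ^ 2)) := by
        gcongr
        exact hhs y
      _ = _ := by ring
  have hboundB {s : ℝ} (y : E) (hs : |s| ≤ |K (p y) - K (p (-y))|) :
      ‖s * h (-y)‖ ≤ D * B * (min 1 (‖y‖ ^ 2) / ‖y‖ ^ 4) := by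
    have hmin : min 1 (‖y‖ ^ 2) = min 1 ‖y‖ * min 1 ‖y‖ := by
      have := norm_nonneg y
      rcases le_total 1 ‖y‖ with h | h
      · rw [min_eq_left h, min_eq_left (by nlinarith)]; ring
      · rw [min_eq_right h, min_eq_right (by nlinarith)]; ring
    calc ‖s * h (-y)‖ = |s| * |h (-y)| := by simp
      _ ≤ (D * min 1 ‖y‖ / ‖y‖ ^ 4) * (B * min 1 ‖y‖) := by
        gcongr
        · exact hs.trans (hKd y)
        · simpa using hhb (-y)
      _ = _ := by rw [hmin]; ring
  have hIA := ((hG.const_mul ((C + C / a ^ 4) * B)).mono'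
    ((hK.sub (hK.comp hpm)).mul (hh.add hhm')).aestronglyMeasurable
    (ae_of_all _ fun y => hboundA y le_rfl le_rfl))
  have hIB := ((hG.const_mul (D * B)).mono'
    (((hK.comp hpm).sub (hK.comp hpm')).mul hhm').aestronglyMeasurable
    (ae_of_all _ fun y => hboundB y le_rfl))
  refine ⟨hIA, hIB, ?_⟩
  have hset (ε : ℝ) : MeasurableSet {y : E | ε ≤ ‖p y‖} :=
    measurableSet_le measurable_const hpm.norm
  have hlimA : Tendsto (fun ε => ∫ y,
      (truncatedKernel K ε y - truncatedKernel K ε (p y)) * (h y + h (-y)) ∂ν) (𝓝[>] 0)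
      (𝓝 (∫ y, (K y - K (p y)) * (h y + h (-y)) ∂ν)) := by
    refine tendsto_integral_filter_of_dominated_convergence _ (.of_forall fun ε => ?_)
      (.of_forall fun ε => ae_of_all _ fun y => hboundA y (abs_truncatedKernel_le K ε y)
        (abs_truncatedKernel_le K ε (p y))) (hG.const_mul _) ?_
    · have := measurable_truncatedKernel hK ε
      exact ((this.sub (this.comp hpm)).mul (hh.add hhm')).aestronglyMeasurable
    · filter_upwards [hne] with y hy
      exact ((tendsto_truncatedKernel K hy).sub (tendsto_truncatedKernel K (hp0 hy))).mul_const _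
  have hmeasB (ε : ℝ) : Measurable (fun y => {y : E | ε ≤ ‖p y‖}.indicator
      (fun y => K (p y) - K (p (-y))) y * h (-y)) :=
    (((hK.comp hpm).sub (hK.comp hpm')).indicator (hset ε)).mul hhm'
  have hbdB (ε : ℝ) (y : E) := hboundB (s := {y : E | ε ≤ ‖p y‖}.indicator
      (fun y => K (p y) - K (p (-y))) y) y (norm_indicator_le_norm_self (fun y => K (p y) - K (p (-y))) y)
  have hlimB : Tendsto (fun ε => ∫ y, {y : E | ε ≤ ‖p y‖}.indicator
      (fun y => K (p y) - K (p (-y))) y * h (-y) ∂ν) (𝓝[>] 0)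
      (𝓝 (∫ y, (K (p y) - K (p (-y))) * h (-y) ∂ν)) := by
    refine tendsto_integral_filter_of_dominated_convergence _
      (.of_forall fun ε => (hmeasB ε).aestronglyMeasurable)
      (.of_forall fun ε => ae_of_all _ (hbdB ε)) (hG.const_mul _) ?_
    filter_upwards [hne] with y hy
    refine Tendsto.mul_const _ (tendsto_const_nhds.congr' ?_)
    filter_upwards [Ioo_mem_nhdsGT (norm_pos_iff.2 (hp0 hy))] with ε hε
    exact (Set.indicator_of_mem (show y ∈ {y : E | ε ≤ ‖p y‖} from hε.2.le)
      (fun y => K (p y) - K (p (-y)))).symm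
  have hhb1 (y : E) : |h y| ≤ B :=
    (hhb y).trans (mul_le_of_le_one_right hB (min_le_left _ _))
  have hlimR := tendsto_integral_truncatedKernel_sub_mul hE hKb hC hp ha hA hc hpl hpu hp2
    (fun y => (hhb y).trans (mul_le_mul_of_nonneg_left (min_le_right _ _) hB)) hB
  have hlim := (hlimA.add (hlimB.add hlimR)).const_mul (1 / 2)
  rw [add_zero] at hlim
  refine hlim.congr' ?_
  filter_upwards [self_mem_nhdsWithin] with ε (hε : 0 < ε)
  have hint {q : E → E} {a A : ℝ} (hq : Measurable q) (ha : 0 < a) (hA : 0 < A)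
      (hql : ∀ y, a * ‖y‖ ≤ ‖q y‖) (hqu : ∀ y, ‖q y‖ ≤ A * ‖y‖) :
      Integrable (fun y => truncatedKernel K ε (q y) * h y) ν ∧
        Integrable (fun y => truncatedKernel K ε (q y) * h (-y)) ν :=
    ⟨integrable_truncatedKernel_comp_mul hE hK hKb hC hq ha hA hql hqu hh hhb1 hε,
      integrable_truncatedKernel_comp_mul hE hK hKb hC hq ha hA hql hqu hhm'
        (fun y => hhb1 (-y)) hε⟩
  obtain ⟨i0, i0'⟩ := hint (q := fun y => y) measurable_id one_pos one_pos (by simp) (by simp)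
  obtain ⟨i1, i2⟩ := hint hpm ha hA hpl hpu
  obtain ⟨-, i1'⟩ := hint hpm' ha hA (fun y => by simpa using hpl (-y))
    (fun y => by simpa using hpu (-y))
  have e0 : ∫ y, truncatedKernel K ε y * h (-y) ∂ν = ∫ y, truncatedKernel K ε y * h y ∂ν := by
    rw [← integral_neg_eq_self (fun y => truncatedKernel K ε y * h y)]
    simp only [truncatedKernel_neg hKe]
  have e1 : ∫ y, truncatedKernel K ε (p (-y)) * h (-y) ∂ν =
      ∫ y, truncatedKernel K ε (p y) * h y ∂ν :=
    integral_neg_eq_self (fun y => truncatedKernel K ε (p y) * h y) ν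
  have eA : ∫ y, (truncatedKernel K ε y - truncatedKernel K ε (p y)) * (h y + h (-y)) ∂ν =
      (∫ y, truncatedKernel K ε y * h y ∂ν) + (∫ y, truncatedKernel K ε y * h (-y) ∂ν) -
        ((∫ y, truncatedKernel K ε (p y) * h y ∂ν) +
          ∫ y, truncatedKernel K ε (p y) * h (-y) ∂ν) := by
    rw [← integral_add i0 i0', ← integral_add i1 i2]
    refine Eq.trans ?_ (integral_sub (i0.add i0') (i1.add i2))
    congr 1 with y
    ring
  have iB : Integrable (fun y => {y : E | ε ≤ ‖p y‖}.indicator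
      (fun y => K (p y) - K (p (-y))) y * h (-y)) ν :=
    (hG.const_mul _).mono' (hmeasB ε).aestronglyMeasurable (ae_of_all _ (hbdB ε))
  have hpt (y : E) : {y : E | ε ≤ ‖p y‖}.indicator (fun y => K (p y) - K (p (-y))) y +
      ({y : E | ε ≤ ‖p y‖}.indicator (fun y => K (p (-y))) y - truncatedKernel K ε (p (-y))) =
      truncatedKernel K ε (p y) - truncatedKernel K ε (p (-y)) := by
    by_cases hy : ε ≤ ‖p y‖ <;> simp [truncatedKernel, Set.indicator_apply, hy]
  have iR : Integrable (fun y => ({y : E | ε ≤ ‖p y‖}.indicator (fun y => K (p (-y))) y -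
      truncatedKernel K ε (p (-y))) * h (-y)) ν := by
    refine ((i2.sub i1').sub iB).congr (ae_of_all _ fun y => ?_)
    simp only [Pi.sub_apply]
    linear_combination (-h (-y)) * hpt y
  have eB : (∫ y, {y : E | ε ≤ ‖p y‖}.indicator (fun y => K (p y) - K (p (-y))) y * h (-y) ∂ν) +
      (∫ y, ({y : E | ε ≤ ‖p y‖}.indicator (fun y => K (p (-y))) y -
        truncatedKernel K ε (p (-y))) * h (-y) ∂ν) =
      (∫ y, truncatedKernel K ε (p y) * h (-y) ∂ν) -
        ∫ y, truncatedKernel K ε (p (-y)) * h (-y) ∂ν := by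
    rw [← integral_add iB iR, ← integral_sub i2 i1']
    congr 1 with y
    rw [← add_mul, hpt, sub_mul]
  rw [setIntegral_eq_integral_truncatedKernel hpm,
    setIntegral_eq_integral_truncatedKernel (q := fun y => y) measurable_id, eA, eB, e0, e1]
  ring

end SingularIntegral

section Kernel

variable {F : ℝ} {x y : EuclideanSpace ℝ (Fin 3)}

lemma norm_sq_le_normInvFsq (hF : F ∈ Set.Ioc (0 : ℝ) 1) (y : EuclideanSpace ℝ (Fin 3)) :
    ‖y‖ ^ 2 ≤ normInvFsq F y := by
  have hF0 : 0 < F := hF.1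
  rw [EuclideanSpace.real_norm_sq_eq, Fin.sum_univ_three, normInvFsq]
  have : y 2 ^ 2 ≤ y 2 ^ 2 / F ^ 2 :=
    le_div_self (sq_nonneg _) (by positivity) (pow_le_one₀ hF0.le hF.2)
  linarith

lemma norm_le_normInvF (hF : F ∈ Set.Ioc (0 : ℝ) 1) (y : EuclideanSpace ℝ (Fin 3)) :
    ‖y‖ ≤ normInvF F y :=
  Real.le_sqrt_of_sq_le (norm_sq_le_normInvFsq hF y)

lemma normInvF_le (hF : F ∈ Set.Ioc (0 : ℝ) 1) (y : EuclideanSpace ℝ (Fin 3)) :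
    normInvF F y ≤ ‖y‖ / F := by
  have hF0 : 0 < F := hF.1
  refine Real.sqrt_le_iff.2 ⟨by positivity, ?_⟩
  have hF1 : F ^ 2 ≤ 1 := pow_le_one₀ hF0.le hF.2
  have h0 : y 0 ^ 2 ≤ y 0 ^ 2 / F ^ 2 := le_div_self (sq_nonneg _) (by positivity) hF1
  have h1 : y 1 ^ 2 ≤ y 1 ^ 2 / F ^ 2 := le_div_self (sq_nonneg _) (by positivity) hF1
  rw [div_pow, EuclideanSpace.real_norm_sq_eq, Fin.sum_univ_three, normInvFsq, add_div, add_div]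
  linarith

lemma normInvFsq_nonneg (F : ℝ) (y : EuclideanSpace ℝ (Fin 3)) : 0 ≤ normInvFsq F y := by
  unfold normInvFsq
  positivity

lemma measurable_K₀ (F : ℝ) : Measurable (K₀ F) := by
  have hcoord (i : Fin 3) : Measurable fun y : EuclideanSpace ℝ (Fin 3) => y i :=
    (EuclideanSpace.proj i).continuous.measurable
  have := hcoord 0
  have := hcoord 1
  have := hcoord 2
  unfold K₀ normInvFsq
  fun_prop

lemma K₀_neg (F : ℝ) (y : EuclideanSpace ℝ (Fin 3)) : K₀ F (-y) = K₀ F y := by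
  simp [K₀, normInvFsq]

lemma abs_K₀_le (hF : F ∈ Set.Ioc (0 : ℝ) 1) (y : EuclideanSpace ℝ (Fin 3)) :
    |K₀ F y| ≤ 6 / F ^ 2 / ‖y‖ ^ 4 := by
  have hF0 : 0 < F := hF.1
  rcases eq_or_ne y 0 with rfl | hy
  · simp [K₀]
  have hy := norm_pos_iff.2 hy
  have hN := norm_sq_le_normInvFsq hF y
  have hN0 : 0 < normInvFsq F y := lt_of_lt_of_le (by positivity) hN
  have hnum : |y 0 ^ 2 + y 1 ^ 2 - 3 * y 2 ^ 2 / F ^ 2| ≤ 3 * normInvFsq F y := by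
    have h2 : 0 ≤ y 2 ^ 2 / F ^ 2 := by positivity
    rw [normInvFsq, mul_div_assoc, abs_le]
    constructor <;> nlinarith [sq_nonneg (y 0), sq_nonneg (y 1)]
  calc |K₀ F y| = 2 / F ^ 2 * |y 0 ^ 2 + y 1 ^ 2 - 3 * y 2 ^ 2 / F ^ 2| / normInvFsq F y ^ 3 := by
        rw [K₀, abs_div, abs_mul, abs_neg, abs_of_pos (by positivity : 0 < 2 / F ^ 2),
          abs_of_pos (pow_pos hN0 3)]
    _ ≤ 2 / F ^ 2 * (3 * normInvFsq F y) / normInvFsq F y ^ 3 := by gcongr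
    _ = 6 / F ^ 2 / normInvFsq F y ^ 2 := by field_simp; norm_num
    _ ≤ 6 / F ^ 2 / (‖y‖ ^ 2) ^ 2 := by gcongr
    _ = _ := by rw [← pow_mul]

lemma K₀_eq (hF : 0 < F) (hy : 0 < normInvF F y) :
    K₀ F y = -(2 / F ^ 2) *
      ((normInvF F y)⁻¹ ^ 4 * (1 - 4 * (y 2 / F * (normInvF F y)⁻¹) ^ 2)) := by
  have hsq : normInvFsq F y = normInvF F y ^ 2 := (Real.sq_sqrt (normInvFsq_nonneg F y)).symm
  have hnum : y 0 ^ 2 + y 1 ^ 2 - 3 * y 2 ^ 2 / F ^ 2 =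
      normInvF F y ^ 2 - 4 * (y 2 / F) ^ 2 := by
    rw [← hsq, normInvFsq]
    ring
  rw [K₀, hnum, hsq]
  field_simp

lemma abs_div_mul_inv_normInvF_le (F : ℝ) (y : EuclideanSpace ℝ (Fin 3)) :
    |y 2 / F * (normInvF F y)⁻¹| ≤ 1 := by
  have h0 : 0 ≤ normInvF F y := Real.sqrt_nonneg _
  rw [← div_eq_mul_inv, abs_div, abs_of_nonneg h0]
  refine div_le_one_of_le₀ (Real.abs_le_sqrt ?_) h0
  rw [normInvFsq, div_pow]
  nlinarith [sq_nonneg (y 0), sq_nonneg (y 1)]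

lemma abs_K₀_sub_le (hF : 0 < F) {r d : ℝ} (hr : 0 < r) (hx : r ≤ normInvF F x)
    (hy : r ≤ normInvF F y) (hd : |normInvF F x - normInvF F y| ≤ d)
    (hd2 : |x 2 / F + y 2 / F| ≤ d) :
    |K₀ F x - K₀ F y| ≤ 56 / F ^ 2 * (d / r ^ 5) := by
  have hs : 0 < normInvF F x := hr.trans_le hx
  have ht : 0 < normInvF F y := hr.trans_le hy
  rw [K₀_eq hF hs, K₀_eq hF ht]
  have hα := abs_div_mul_inv_normInvF_le F x
  have hβ := abs_div_mul_inv_normInvF_le F y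
  set s := normInvF F x
  set t := normInvF F y
  set α := x 2 / F * s⁻¹ with hαdef
  set β := y 2 / F * t⁻¹ with hβdef
  have hd0 : 0 ≤ d := (abs_nonneg _).trans hd
  have hu0 : 0 < s⁻¹ := inv_pos.2 hs
  have hv0 : 0 < t⁻¹ := inv_pos.2 ht
  have hu : s⁻¹ ≤ r⁻¹ := inv_anti₀ hr hx
  have hv : t⁻¹ ≤ r⁻¹ := inv_anti₀ hr hy
  have huv : |s⁻¹ - t⁻¹| ≤ d * r⁻¹ ^ 2 := by
    have : s⁻¹ - t⁻¹ = -(s - t) * (s⁻¹ * t⁻¹) := by field_simp; ring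
    rw [this, abs_mul, abs_neg, abs_of_pos (mul_pos hu0 hv0), pow_two]
    gcongr
  have huv4 : |s⁻¹ ^ 4 - t⁻¹ ^ 4| ≤ 4 * (d * r⁻¹ ^ 5) := by
    have : s⁻¹ ^ 4 - t⁻¹ ^ 4 =
        (s⁻¹ - t⁻¹) * (s⁻¹ ^ 3 + s⁻¹ ^ 2 * t⁻¹ + s⁻¹ * t⁻¹ ^ 2 + t⁻¹ ^ 3) := by ring
    rw [this, abs_mul, abs_of_pos (a := s⁻¹ ^ 3 + _ + _ + _) (by positivity)]
    calc _ ≤ (d * r⁻¹ ^ 2) * (r⁻¹ ^ 3 + r⁻¹ ^ 2 * r⁻¹ + r⁻¹ * r⁻¹ ^ 2 + r⁻¹ ^ 3) := by gcongr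
      _ = _ := by ring
  have hαβ : |α + β| ≤ 2 * (d * r⁻¹) := by
    have : α + β = (x 2 / F + y 2 / F) * s⁻¹ + β * (s - t) * s⁻¹ := by
      rw [hαdef, hβdef]; field_simp; ring
    rw [this]
    refine (abs_add_le _ _).trans ?_
    rw [abs_mul, abs_mul, abs_mul, abs_of_pos hu0]
    calc _ ≤ d * r⁻¹ + 1 * d * r⁻¹ := by gcongr
      _ = _ := by ring
  have hαβ2 : |α ^ 2 - β ^ 2| ≤ 4 * (d * r⁻¹) := by
    rw [sq_sub_sq, abs_mul]
    calc _ ≤ 2 * (d * r⁻¹) * (1 + 1) := by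
          gcongr
          exact (abs_sub α β).trans (add_le_add hα hβ)
      _ = _ := by ring
  have hβ3 : |1 - 4 * β ^ 2| ≤ 3 := by
    have := (sq_le_one_iff_abs_le_one β).2 hβ
    rw [abs_le]
    constructor <;> nlinarith [sq_nonneg β]
  have hsplit : -(2 / F ^ 2) * (s⁻¹ ^ 4 * (1 - 4 * α ^ 2)) -
      -(2 / F ^ 2) * (t⁻¹ ^ 4 * (1 - 4 * β ^ 2)) =
      -(2 / F ^ 2) * ((s⁻¹ ^ 4 - t⁻¹ ^ 4) * (1 - 4 * β ^ 2) - 4 * s⁻¹ ^ 4 * (α ^ 2 - β ^ 2)) := by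
    ring
  rw [hsplit, abs_mul, abs_neg, abs_of_pos (by positivity : 0 < 2 / F ^ 2)]
  calc _ ≤ 2 / F ^ 2 * (4 * (d * r⁻¹ ^ 5) * 3 + 4 * r⁻¹ ^ 4 * (4 * (d * r⁻¹))) := by
        gcongr
        refine (abs_sub _ _).trans ?_
        rw [abs_mul, abs_mul, abs_of_pos (by positivity : 0 < 4 * s⁻¹ ^ 4)]
        gcongr
    _ = _ := by
        rw [div_eq_mul_inv d, ← inv_pow]
        ring

end Kernel

/-- Rewriting of the singular-integral commutator (Proposition 3.6): the limit
`L = lim_{ε→0⁺} [∫_{|y|≥ε} K₀(y)h(y) dy − ∫_{|m(−y)|≥ε} K₀(m(−y))h(y) dy]` exists,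
the integrals `𝔸 = ∫ (K₀(y) − K₀(m(−y)))(h(y)+h(−y)) dy` and
`𝔹 = ∫ (K₀(m(−y)) − K₀(m(y))) h(−y) dy` converge absolutely, and `L = (𝔸 + 𝔹)/2`. -/
theorem commutator_rewriting
    (F : ℝ) (hF : F ∈ Set.Ioc (0 : ℝ) 1)
    (V μ : ℝ) (hV : 0 ≤ V) (hV2 : Real.exp (2 * V) - 1 ≤ 1 / 2) (hμ : 0 < μ)
    (m : EuclideanSpace ℝ (Fin 3) → EuclideanSpace ℝ (Fin 3))
    (hbij : Function.Bijective m)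
    (hmp : MeasurePreserving m (volume : Measure (EuclideanSpace ℝ (Fin 3))) volume)
    -- (i)
    (h1 : ∀ y : EuclideanSpace ℝ (Fin 3), y ≠ 0 →
      (Real.exp (-V) * ‖y‖ ≤ ‖m y‖ ∧ ‖m y‖ ≤ Real.exp V * ‖y‖) ∧
      (Real.exp (-V) * ‖y‖ ≤ ‖m (-y)‖ ∧ ‖m (-y)‖ ≤ Real.exp V * ‖y‖) ∧
      (Real.exp (-V) * normInvF F y ≤ normInvF F (m y) ∧
        normInvF F (m y) ≤ Real.exp V * normInvF F y) ∧
      (Real.exp (-V) * normInvF F y ≤ normInvF F (m (-y)) ∧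
        normInvF F (m (-y)) ≤ Real.exp V * normInvF F y))
    -- (ii)
    (h2 : ∀ y : EuclideanSpace ℝ (Fin 3), y ≠ 0 →
      ‖m (-y) - y‖ ≤ Real.exp (2 * V) * (Real.exp (2 * V) - 1) * ‖y‖ ∧
      ‖m y + y‖ ≤ Real.exp (2 * V) * (Real.exp (2 * V) - 1) * ‖y‖)
    -- (iii)
    (h3 : ∀ y : EuclideanSpace ℝ (Fin 3), y ≠ 0 →
      ‖m (-y) + m y‖ ≤ Real.exp (2 * V) * (Real.exp (2 * V) - 1) * min 1 (μ * ‖y‖) * ‖y‖)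
    -- (iv)
    (h4 : ∀ y : EuclideanSpace ℝ (Fin 3), y ≠ 0 →
      |‖m (-y)‖ - ‖m y‖| ≤ Real.exp (2 * V) * (Real.exp (2 * V) - 1) * min 1 (μ * ‖y‖) * ‖y‖ ∧
      |normInvF F (m (-y)) - normInvF F (m y)| ≤
        Real.exp (2 * V) * (Real.exp (2 * V) - 1) * min 1 (μ * ‖y‖) * normInvF F y)
    (h : EuclideanSpace ℝ (Fin 3) → ℝ)
    (hh : ContDiff ℝ 2 h) (hh0 : h 0 = 0)
    (B₀ B₁ B₂ : ℝ)
    (hb0 : ∀ x, |h x| ≤ B₀) (hb1 : ∀ x, ‖fderiv ℝ h x‖ ≤ B₁)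
    (hb2 : ∀ x, ‖iteratedFDeriv ℝ 2 h x‖ ≤ B₂) :
    Integrable (fun y : EuclideanSpace ℝ (Fin 3) =>
      (K₀ F y - K₀ F (m (-y))) * (h y + h (-y))) volume ∧
    Integrable (fun y : EuclideanSpace ℝ (Fin 3) =>
      (K₀ F (m (-y)) - K₀ F (m y)) * h (-y)) volume ∧
    Tendsto (fun ε : ℝ =>
        (∫ y in {y : EuclideanSpace ℝ (Fin 3) | ε ≤ ‖y‖}, K₀ F y * h y) -
          ∫ y in {y : EuclideanSpace ℝ (Fin 3) | ε ≤ ‖m (-y)‖}, K₀ F (m (-y)) * h y)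
      (𝓝[>] 0)
      (𝓝 ((1 / 2) *
        ((∫ y : EuclideanSpace ℝ (Fin 3), (K₀ F y - K₀ F (m (-y))) * (h y + h (-y))) +
          ∫ y : EuclideanSpace ℝ (Fin 3), (K₀ F (m (-y)) - K₀ F (m y)) * h (-y)))) := by
  have hF0 : 0 < F := hF.1
  set δ := Real.exp (2 * V) * (Real.exp (2 * V) - 1)
  have hδ : 0 ≤ δ := mul_nonneg (Real.exp_pos _).le (by simpa using hV)
  have hm0 : m 0 = 0 := by
    obtain ⟨y, hy⟩ := hbij.2 0
    rcases eq_or_ne y 0 with rfl | hy0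
    · exact hy
    · have h0 := (h1 y hy0).1.1
      have : 0 < Real.exp (-V) * ‖y‖ := mul_pos (Real.exp_pos _) (norm_pos_iff.2 hy0)
      rw [hy, norm_zero] at h0
      linarith
  have hpl (y : EuclideanSpace ℝ (Fin 3)) : Real.exp (-V) * ‖y‖ ≤ ‖m (-y)‖ := by
    rcases eq_or_ne y 0 with rfl | hy
    · simp
    · exact (h1 y hy).2.1.1
  have hpu (y : EuclideanSpace ℝ (Fin 3)) : ‖m (-y)‖ ≤ Real.exp V * ‖y‖ := by
    rcases eq_or_ne y 0 with rfl | hy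
    · simp [hm0]
    · exact (h1 y hy).2.1.2
  have hp2 (y : EuclideanSpace ℝ (Fin 3)) : |‖m (-y)‖ - ‖m (- -y)‖| ≤ δ * μ * ‖y‖ ^ 2 := by
    rcases eq_or_ne y 0 with rfl | hy
    · simp
    · rw [neg_neg]
      calc _ ≤ δ * min 1 (μ * ‖y‖) * ‖y‖ := (h4 y hy).1
        _ ≤ δ * (μ * ‖y‖) * ‖y‖ := by gcongr; exact min_le_right _ _
        _ = _ := by ring
  have hKd (y : EuclideanSpace ℝ (Fin 3)) : |K₀ F (m (-y)) - K₀ F (m (- -y))| ≤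
      56 / F ^ 3 * δ * (1 + μ) / Real.exp (-V) ^ 5 * min 1 ‖y‖ / ‖y‖ ^ 4 := by
    rcases eq_or_ne y 0 with rfl | hy
    · simp
    rw [neg_neg]
    have hy0 := norm_pos_iff.2 hy
    have hmin0 : 0 ≤ min 1 (μ * ‖y‖) := by positivity
    have hmin : min 1 (μ * ‖y‖) ≤ (1 + μ) * min 1 ‖y‖ := by
      rcases le_total 1 ‖y‖ with h | h
      · rw [min_eq_left h]
        exact (min_le_left _ _).trans (by linarith)
      · rw [min_eq_right h]
        exact (min_le_right _ _).trans (by nlinarith)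
    have hd : |normInvF F (m (-y)) - normInvF F (m y)| ≤ δ * min 1 (μ * ‖y‖) * (‖y‖ / F) :=
      (h4 y hy).2.trans (by gcongr; exact normInvF_le hF y)
    have hd2 : |m (-y) 2 / F + m y 2 / F| ≤ δ * min 1 (μ * ‖y‖) * (‖y‖ / F) := by
      rw [← add_div, abs_div, abs_of_pos hF0, ← mul_div_assoc]
      gcongr
      exact (PiLp.norm_apply_le (m (-y) + m y) 2).trans (h3 y hy)
    refine (abs_K₀_sub_le hF0 (mul_pos (Real.exp_pos (-V)) hy0)
      ((hpl y).trans (norm_le_normInvF hF _))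
      ((h1 y hy).1.1.trans (norm_le_normInvF hF _)) hd hd2).trans ?_
    calc _ = 56 / F ^ 3 * δ / Real.exp (-V) ^ 5 / ‖y‖ ^ 4 * min 1 (μ * ‖y‖) := by
          field_simp
      _ ≤ 56 / F ^ 3 * δ / Real.exp (-V) ^ 5 / ‖y‖ ^ 4 * ((1 + μ) * min 1 ‖y‖) := by gcongr
      _ = _ := by ring
  have hB₀ : 0 ≤ B₀ := (abs_nonneg _).trans (hb0 0)
  have hB₁ : 0 ≤ B₁ := (norm_nonneg _).trans (hb1 0)
  have hB₂ : 0 ≤ B₂ := (norm_nonneg _).trans (hb2 0)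
  have hhb (y : EuclideanSpace ℝ (Fin 3)) : |h y| ≤ (2 * B₀ + B₁ + 2 * B₂) * min 1 ‖y‖ := by
    have hlip : |h y| ≤ B₁ * ‖y‖ := by
      simpa [hh0] using convex_univ.norm_image_sub_le_of_norm_fderiv_le (𝕜 := ℝ)
        (fun x _ => hh.differentiable (by norm_num) x) (fun x _ => hb1 x)
        (Set.mem_univ 0) (Set.mem_univ y)
    rcases le_total 1 ‖y‖ with h | h
    · rw [min_eq_left h]
      linarith [hb0 y]
    · rw [min_eq_right h]
      nlinarith [norm_nonneg y]
  have hhs (y : EuclideanSpace ℝ (Fin 3)) :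
      |h y + h (-y)| ≤ (2 * B₀ + B₁ + 2 * B₂) * min 1 (‖y‖ ^ 2) := by
    rcases le_total 1 (‖y‖ ^ 2) with h' | h'
    · rw [min_eq_left h']
      linarith [abs_add_le (h y) (h (-y)), hb0 y, hb0 (-y)]
    · rw [min_eq_right h']
      nlinarith [abs_add_comp_neg_le hh hh0 hb2 y, sq_nonneg ‖y‖]
  simpa only [neg_neg] using tendsto_truncated_commutator (p := fun y => m (-y)) (by simp)
    (measurable_K₀ F) (K₀_neg F) (abs_K₀_le hF) (by positivity)
    (hmp.comp (Measure.measurePreserving_neg volume)) (Real.exp_pos (-V)) (Real.exp_pos V)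
    (by positivity) hpl hpu hp2 (by positivity) hKd hh.continuous.measurable hhb (by positivity)
    hhs
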